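/- Let F have characteristic 0 or prime characteristic p ≥ m, J = J_m(0), and D = diag(α, α−1, ..., α−(m−1)). Then the group G = {I + f(J) : f(0)=0} acts regularly (simply transitively) by conjugation on the set Y = {D + f(J) : f ∈ F[X], f(0) = 0}; in particular, every matrix of the form D + f(J) with f(0)=0 is conjugate to D by an element of G. -/

import Mathlib

/-- The m×m upper triangular Jordan block with eigenvalue α. -/
def jordanBlock {F : Type*} [Field F] (m : ℕ) (α : F) :
    Matrix (Fin m) (Fin m) F :=
  fun i j => if (i : ℕ) + 1 = (j : ℕ) then 1 else if i = j then α else 0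

open Polynomial in
theorem jb_pow {F : Type*} [Field F] (m : ℕ) (k : ℕ) (i j : Fin m) :
    ((jordanBlock m (0:F)) ^ k) i j = if (i:ℕ) + k = (j:ℕ) then 1 else 0 := by
  induction k generalizing i j with
  | zero => simp [Matrix.one_apply, Fin.ext_iff]
  | succ k ih =>
    rw [pow_succ, Matrix.mul_apply]
    simp only [ih]
    have hJ : ∀ l : Fin m, jordanBlock m (0:F) l j = if (l:ℕ) + 1 = (j:ℕ) then 1 else 0 := by
      intro l; simp [jordanBlock]
    simp only [hJ]
    by_cases h : (i:ℕ) + (k+1) = j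
    · have hl : (i:ℕ) + k < m := by have := j.2; omega
      rw [if_pos h, Finset.sum_eq_single (⟨(i:ℕ)+k, hl⟩ : Fin m)]
      · simp only [if_true, one_mul]
        rw [if_pos (by omega)]
      · intro b _ hb
        rw [if_neg, zero_mul]
        intro h'; exact hb (Fin.ext h'.symm)
      · simp
    · rw [if_neg h]
      apply Finset.sum_eq_zero
      intro l _
      by_cases h1 : (i:ℕ) + k = l
      · rw [if_neg (c := (l:ℕ)+1 = j) (by omega), mul_zero]
      · rw [if_neg h1, zero_mul]

open Polynomial in
theorem jb_aeval {F : Type*} [Field F] (m : ℕ) (p : F[X]) (i j : Fin m) :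
    (aeval (jordanBlock m (0:F)) p) i j =
      if (i:ℕ) ≤ j then p.coeff ((j:ℕ) - i) else 0 := by
  induction p using Polynomial.induction_on' with
  | add p q hp hq =>
    rw [map_add, Matrix.add_apply, hp, hq]
    split_ifs <;> simp
  | monomial n a =>
    rw [aeval_monomial, Algebra.algebraMap_eq_smul_one, smul_mul_assoc, one_mul,
      Matrix.smul_apply, jb_pow, coeff_monomial]
    by_cases h : (i:ℕ) + n = j
    · rw [if_pos h, if_pos (by omega), if_pos (by omega)]; simp
    · rw [if_neg h]
      by_cases h2 : (i:ℕ) ≤ j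
      · rw [if_pos h2, if_neg (by omega)]; simp
      · rw [if_neg h2]; simp

open Polynomial in
theorem jb_aeval_eq_zero {F : Type*} [Field F] (m : ℕ) (p : F[X]) :
    aeval (jordanBlock m (0:F)) p = 0 ↔ ∀ k < m, p.coeff k = 0 := by
  constructor
  · intro h k hk
    have := congrFun (congrFun h ⟨0, by omega⟩) ⟨k, hk⟩
    rw [jb_aeval] at this
    simpa using this
  · intro h
    ext i j
    rw [jb_aeval]
    split_ifs
    · rw [h _ (by have := j.2; omega)]; rfl
    · rfl

open Polynomial in
theorem jb_comm {F : Type*} [Field F] (m : ℕ) (α : F) (p : F[X]) :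
    Matrix.diagonal (fun i : Fin m => α - (i : ℕ)) * aeval (jordanBlock m (0:F)) p =
    aeval (jordanBlock m (0:F)) p * Matrix.diagonal (fun i : Fin m => α - (i : ℕ))
      + aeval (jordanBlock m (0:F)) (X * derivative p) := by
  ext i j
  rw [Matrix.add_apply, Matrix.diagonal_mul, Matrix.mul_diagonal, jb_aeval, jb_aeval]
  split_ifs with h
  · have hc : ∀ n, (X * derivative p).coeff n = p.coeff n * (n:F) := by
      intro n
      cases n with
      | zero => simp
      | succ n => rw [coeff_X_mul, coeff_derivative]; push_cast; rfl
    rw [hc, Nat.cast_sub h]; ring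
  · simp

open Polynomial in
theorem jb_det {F : Type*} [Field F] (m : ℕ) (p : F[X]) (hp : p.coeff 0 = 1) :
    (aeval (jordanBlock m (0:F)) p).det = 1 := by
  rw [Matrix.det_of_isUpperTriangular]
  · simp [jb_aeval, hp]
  · intro i j hij
    rw [jb_aeval, if_neg]
    simpa using hij

open Polynomial in
theorem jb_coeffXD {F : Type*} [Field F] (p : F[X]) (n : ℕ) :
    (X * derivative p).coeff n = p.coeff n * (n:F) := by
  cases n with
  | zero => simp
  | succ n => rw [coeff_X_mul, coeff_derivative]; push_cast; rfl

open Polynomial in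
theorem jb_exists {F : Type*} [Field F] (m : ℕ) (hk : ∀ k, 0 < k → k < m → (k:F) ≠ 0)
    (q : F[X]) (hq : q.coeff 0 = 0) (n : ℕ) (hn : n ≤ m) :
    ∃ t : F[X], t.coeff 0 = 1 ∧ ∀ k < n, (X * derivative t - q * t).coeff k = 0 := by
  induction n with
  | zero => exact ⟨1, by simp, by simp⟩
  | succ n ih =>
    obtain ⟨t, h0, ht⟩ := ih (by omega)
    rcases Nat.eq_zero_or_pos n with rfl | hpos
    · refine ⟨t, h0, ?_⟩
      intro k hk
      obtain rfl : k = 0 := by omega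
      simp [hq]
    · have hne := hk n hpos (by omega)
      set r := (X * derivative t - q * t).coeff n with hr
      refine ⟨t - C (r / n) * X ^ n, ?_, ?_⟩
      · simp [h0, coeff_X_pow, hpos.ne]
      · intro k hkn
        have e : X * derivative (t - C (r / n) * X ^ n) - q * (t - C (r / n) * X ^ n) =
          (X * derivative t - q * t) - X * derivative (C (r / n) * X ^ n)
            + (C (r/n) * q) * X ^ n := by
          rw [derivative_sub]; ring
        rw [e, coeff_add, coeff_sub, jb_coeffXD, coeff_C_mul_X_pow, coeff_mul_X_pow']
        rcases Nat.lt_succ_iff_lt_or_eq.mp hkn with h | rfl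
        · rw [ht k h, if_neg (by omega), if_neg (by omega)]; simp
        · rw [← hr]; simp [hq, hne]

open Polynomial in
theorem jb_unique {F : Type*} [Field F] (m : ℕ) (hk : ∀ k, 0 < k → k < m → (k:F) ≠ 0)
    (q : F[X]) (hq : q.coeff 0 = 0) (d : F[X]) (hd : d.coeff 0 = 0)
    (h : ∀ k < m, (X * derivative d - q * d).coeff k = 0) : ∀ k < m, d.coeff k = 0 := by
  intro k
  induction k using Nat.strong_induction_on with
  | _ k ih =>
    intro hkm
    rcases Nat.eq_zero_or_pos k with rfl | hpos
    · exact hd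
    · have := h k hkm
      rw [coeff_sub, jb_coeffXD, coeff_mul, Finset.sum_eq_zero, sub_zero] at this
      · exact (mul_eq_zero.mp this).resolve_right (hk k hpos hkm)
      · rintro ⟨a, b⟩ hab
        have hab : a + b = k := by simpa using hab
        rcases Nat.eq_zero_or_pos a with rfl | ha
        · simp [hq]
        · simp [ih b (by omega) (by omega)]

open Polynomial in
theorem jb_conj {F : Type*} [Field F] (m : ℕ) (α : F) (f g t : F[X]) (ht : t.coeff 0 = 1) :
    aeval (jordanBlock m (0:F)) t *
      (Matrix.diagonal (fun i : Fin m => α - (i : ℕ)) + aeval (jordanBlock m (0:F)) f) *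
      (aeval (jordanBlock m (0:F)) t)⁻¹ =
      Matrix.diagonal (fun i : Fin m => α - (i : ℕ)) + aeval (jordanBlock m (0:F)) g ↔
    ∀ k < m, (X * derivative t - (f - g) * t).coeff k = 0 := by
  have hu : IsUnit (aeval (jordanBlock m (0:F)) t).det := by rw [jb_det m t ht]; exact isUnit_one
  rw [← jb_aeval_eq_zero]
  have h1 : ∀ A B : Matrix (Fin m) (Fin m) F,
      A * (aeval (jordanBlock m (0:F)) t)⁻¹ = B ↔ A = B * aeval (jordanBlock m (0:F)) t := by
    intro A B
    constructor
    · rintro rfl; rw [Matrix.nonsing_inv_mul_cancel_right _ _ hu]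
    · rintro rfl; rw [Matrix.mul_nonsing_inv_cancel_right _ _ hu]
  rw [h1, mul_add, add_mul, jb_comm, ← map_mul, ← map_mul, add_assoc, add_right_inj, ← map_add,
    ← sub_eq_zero, ← map_sub, ← neg_eq_zero, ← map_neg]
  have : -(t * f - (X * derivative t + g * t)) = X * derivative t - (f - g) * t := by ring
  rw [this]

theorem stmt12 {F : Type*} [Field F] [IsAlgClosed F] {m : ℕ} (hm : 1 ≤ m)
    (hchar : ringChar F = 0 ∨ ((ringChar F).Prime ∧ m ≤ ringChar F)) (α : F)
    (f g : Polynomial F) (hf : f.coeff 0 = 0) (hg : g.coeff 0 = 0) :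
    letI J : Matrix (Fin m) (Fin m) F := jordanBlock m 0
    letI D : Matrix (Fin m) (Fin m) F :=
      Matrix.diagonal (fun i : Fin m => α - (i : ℕ))
    ∃! T : Matrix (Fin m) (Fin m) F,
      (∃ h : Polynomial F, h.coeff 0 = 0 ∧ T = 1 + Polynomial.aeval J h) ∧
      T * (D + Polynomial.aeval J f) * T⁻¹ = D + Polynomial.aeval J g := by
  have hk : ∀ k : ℕ, 0 < k → k < m → (k:F) ≠ 0 := by
    intro k h0 h1 h
    rw [ringChar.spec] at h
    rcases hchar with hc | ⟨_, hc⟩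
    · rw [hc] at h; have := Nat.eq_zero_of_zero_dvd h; omega
    · have := Nat.le_of_dvd h0 h; omega
  have hq : (f - g).coeff 0 = 0 := by simp [hf, hg]
  obtain ⟨t, ht0, ht⟩ := jb_exists m hk (f - g) hq m le_rfl
  refine ⟨Polynomial.aeval (jordanBlock m (0:F)) t, ⟨⟨t - 1, by simp [ht0], by simp⟩,
    (jb_conj m α f g t ht0).2 ht⟩, ?_⟩
  rintro T ⟨⟨h, h0, rfl⟩, hT⟩
  have e : (1 : Matrix (Fin m) (Fin m) F) + Polynomial.aeval (jordanBlock m (0:F)) h = Polynomial.aeval (jordanBlock m (0:F)) (1 + h) := by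
    simp
  have hs0 : (1 + h).coeff 0 = 1 := by simp [h0]
  rw [e] at hT ⊢
  have hs := (jb_conj m α f g (1 + h) hs0).1 hT
  rw [← sub_eq_zero, ← map_sub, jb_aeval_eq_zero]
  refine jb_unique m hk (f - g) hq _ (by rw [Polynomial.coeff_sub, hs0, ht0, sub_self]) ?_
  intro k hkm
  have e2 : Polynomial.X * Polynomial.derivative (1 + h - t) - (f - g) * (1 + h - t) =
    (Polynomial.X * Polynomial.derivative (1 + h) - (f - g) * (1 + h)) -
    (Polynomial.X * Polynomial.derivative t - (f - g) * t) := by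
    rw [Polynomial.derivative_sub]; ring
  rw [e2, Polynomial.coeff_sub, hs k hkm, ht k hkm, sub_self]
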